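/- arXiv:1112.3285 — 7 statements merged into one kernel-verified Lean document; each statement's English description precedes it below -/
import Mathlib

section
/- For every θ > 0 and all Schwartz functions f, g : ℝ² → ℂ, the integral over ℝ² of the Moyal product f ⋆ g equals the integral of g ⋆ f, and both equal the integral of the pointwise product f·g: ∫_{ℝ²} (f ⋆ g)(x) dx = ∫_{ℝ²} (g ⋆ f)(x) dx = ∫_{ℝ²} f(x) g(x) dx. -/
open MeasureTheory Complex

noncomputable section

abbrev E2 := EuclideanSpace ℝ (Fin 2)

/-- The Moyal star product of two functions on ℝ², with deformation parameter θ: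
`(f ⋆ g)(x) = (πθ)⁻² ∬ f(x+y) g(x+z) e^{−2i y·Θ⁻¹z} dy dz` where
`y·Θ⁻¹z = (y₂z₁ − y₁z₂)/θ`. -/
def moyal (θ : ℝ) (f g : E2 → ℂ) : E2 → ℂ := fun x =>
  (((Real.pi * θ) ^ 2)⁻¹ : ℝ) • ∫ y : E2, ∫ z : E2,
    f (x + y) * g (x + z) *
      Complex.exp (-(2 * Complex.I) * ((((y 1) * (z 0) - (y 0) * (z 1)) / θ : ℝ) : ℂ))

open scoped FourierTransform RealInnerProductSpace in
/-- Fubini for a Fourier-type double integral along a phase `w y` orthogonal to `y`. -/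
theorem integral_integral_shift_mul_fourier_phase {V : Type*} [NormedAddCommGroup V]
    [InnerProductSpace ℝ V] [FiniteDimensional ℝ V] [MeasurableSpace V] [BorelSpace V]
    (f : SchwartzMap V ℂ) {h : V → ℂ} (hh : Integrable h) {w : V → V} (hw : Continuous w)
    (horth : ∀ y, ⟪y, w y⟫ = 0) :
    ∫ x, ∫ y, f (x + y) * (exp ((2 * Real.pi * ⟪x, w y⟫ : ℝ) * I) * h y) =
      ∫ y, 𝓕⁻ f (w y) * h y := by
  have hint : Integrable (Function.uncurry fun x y ↦
      f (x + y) * (exp ((2 * Real.pi * ⟪x, w y⟫ : ℝ) * I) * h y))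
      ((volume : Measure V).prod volume) := by
    have hprod : Integrable (fun p : V × V ↦ f (p.1 + p.2) * h p.2)
        ((volume : Measure V).prod volume) :=
      (measurePreserving_add_prod volume volume).integrable_comp_of_integrable
        (f.integrable.mul_prod hh)
    have hphase : Continuous fun p : V × V ↦
        exp ((2 * Real.pi * ⟪p.1, w p.2⟫ : ℝ) * I) := by fun_prop
    refine (hprod.bdd_mul (c := 1) hphase.aestronglyMeasurable
      (.of_forall fun p ↦ (norm_exp_ofReal_mul_I _).le)).congr (.of_forall fun p ↦ ?_)
    simp only [Function.uncurry]
    ring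
  rw [integral_integral_swap hint]
  congr 1 with y
  rw [SchwartzMap.fourierInv_coe, Real.fourierInv_eq', ← integral_mul_const]
  refine Eq.trans ?_ (integral_add_right_eq_self _ y)
  congr 1 with x
  rw [inner_add_left, horth, add_zero, smul_eq_mul]
  ring

/-- The clockwise quarter turn of the plane. -/
def quarterTurn : E2 ≃ₗᵢ[ℝ] E2 :=
  LinearIsometry.toLinearIsometryEquiv
    { toFun := fun y ↦ !₂[y 1, -y 0]
      map_add' := fun x y ↦ by ext i; fin_cases i <;> simp [add_comm]
      map_smul' := fun c y ↦ by ext i; fin_cases i <;> simp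
      norm_map' := fun y ↦ by simp [EuclideanSpace.norm_eq, add_comm] } rfl

theorem inner_quarterTurn (x y : E2) :
    inner ℝ x (quarterTurn y) = x 0 * y 1 - x 1 * y 0 := by
  simp [quarterTurn, PiLp.inner_apply, Fin.sum_univ_two]
  ring

open scoped FourierTransform in
/-- One of the two integrals of the Moyal product is a Fourier transform. -/
theorem moyal_eq_integral_fourier (θ : ℝ) (f g : SchwartzMap E2 ℂ) (x : E2) :
    moyal θ f g x = (((Real.pi * θ) ^ 2)⁻¹ : ℝ) • ∫ y, f (x + y) *
      (exp ((2 * Real.pi * inner ℝ x ((Real.pi * θ)⁻¹ • quarterTurn y) : ℝ) * I) *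
        𝓕 g ((Real.pi * θ)⁻¹ • quarterTurn y)) := by
  rw [moyal]
  congr 2 with y
  rw [SchwartzMap.fourier_coe, Real.fourier_eq', ← integral_const_mul, ← integral_const_mul]
  refine Eq.trans ?_ (integral_add_left_eq_self _ x)
  congr 1 with z
  beta_reduce
  have hphase : -(2 * I) * ((y 1 * z 0 - y 0 * z 1) / θ : ℝ) =
      (2 * Real.pi * inner ℝ x ((Real.pi * θ)⁻¹ • quarterTurn y) : ℝ) * I +
        (-2 * Real.pi * inner ℝ (x + z) ((Real.pi * θ)⁻¹ • quarterTurn y) : ℝ) * I := by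
    simp only [inner_smul_right, inner_quarterTurn, PiLp.add_apply]
    push_cast
    have : (Real.pi : ℂ) ≠ 0 := by exact_mod_cast Real.pi_ne_zero
    rcases eq_or_ne (θ : ℂ) 0 with h | h
    · simp [h]
    · field_simp
      ring
  rw [hphase, exp_add, smul_eq_mul]
  ring

open scoped FourierTransform in
theorem integral_moyal_eq_integral_mul {θ : ℝ} (hθ : 0 < θ) (f g : SchwartzMap E2 ℂ) :
    ∫ x, moyal θ f g x = ∫ x, f x * g x := by
  have hc : 0 < Real.pi * θ := by positivity
  have hmp := quarterTurn.measurePreserving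
  have hscaled : Integrable fun y : E2 ↦ 𝓕 g ((Real.pi * θ)⁻¹ • quarterTurn y) :=
    hmp.integrable_comp_of_integrable (g := fun v ↦ 𝓕 g ((Real.pi * θ)⁻¹ • v))
      ((𝓕 g).integrable.comp_smul (inv_ne_zero hc.ne'))
  have horth (y : E2) : inner ℝ y ((Real.pi * θ)⁻¹ • quarterTurn y) = 0 := by
    rw [inner_smul_right, inner_quarterTurn]
    ring
  have hw : Continuous fun y : E2 ↦ (Real.pi * θ)⁻¹ • quarterTurn y :=
    quarterTurn.continuous.fun_const_smul _
  simp_rw [moyal_eq_integral_fourier]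
  rw [integral_smul, integral_integral_shift_mul_fourier_phase f hscaled hw horth,
    hmp.integral_comp quarterTurn.toHomeomorph.measurableEmbedding
      (fun v ↦ 𝓕⁻ f ((Real.pi * θ)⁻¹ • v) * 𝓕 g ((Real.pi * θ)⁻¹ • v)),
    Measure.integral_comp_smul volume (fun v ↦ 𝓕⁻ f v * 𝓕 g v), smul_smul,
    SchwartzMap.integral_fourierInv_mul_eq, FourierTransform.fourierInv_fourier_eq,
    finrank_euclideanSpace_fin, inv_pow, inv_inv, abs_of_pos (by positivity),
    inv_mul_cancel₀ (by positivity), one_smul]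

/-- The integral is a faithful trace for the Moyal product:
`∫ (f ⋆ g) = ∫ (g ⋆ f) = ∫ f·g`. -/
theorem moyal_integral_trace (θ : ℝ) (hθ : 0 < θ) (f g : SchwartzMap E2 ℂ) :
    ((∫ x : E2, moyal θ (⇑f) (⇑g) x) = ∫ x : E2, moyal θ (⇑g) (⇑f) x) ∧
    ((∫ x : E2, moyal θ (⇑f) (⇑g) x) = ∫ x : E2, f x * g x) := by
  have hfg := integral_moyal_eq_integral_mul hθ f g
  refine ⟨?_, hfg⟩
  rw [hfg, integral_moyal_eq_integral_mul hθ g f]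
  simp_rw [mul_comm]

end
end

section
/- Let γ¹, γ², γ³, γ⁴ be arbitrary complex 4×4 matrices, Ω ∈ (0,1], and define the operator D_Ω on Schwartz functions Ψ : ℝ² → ℂ⁴ by D_Ω Ψ := Σ_{μ=1,2} γ^μ(−i ∂_μ Ψ) − Ω γ^{μ+2}(x̃_μ·Ψ), where matrices act pointwise on values in ℂ⁴. Then for every Schwartz a : ℝ² → ℂ and every Schwartz Ψ : ℝ² → ℂ⁴, D_Ω(a ⋆ Ψ) − a ⋆ (D_Ω Ψ) = −i Σ_{μ=1,2} (γ^μ + Ω γ^{μ+2})((∂_μ a) ⋆ Ψ), where a ⋆ Ψ is the Moyal product taken componentwise. -/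
open MeasureTheory Complex

noncomputable section

/-- Componentwise Moyal product of a scalar function with a vector-valued function. -/
def moyalV {n : Type*} (θ : ℝ) (a : E2 → ℂ) (Ψ : E2 → n → ℂ) : E2 → n → ℂ :=
  fun x i => moyal θ a (fun y => Ψ y i) x

/-- Partial derivative in the μ-th coordinate direction. -/
def pd {V : Type*} [NormedAddCommGroup V] [NormedSpace ℝ V] (μ : Fin 2) (f : E2 → V) :
    E2 → V := fun x => fderiv ℝ f x (EuclideanSpace.single μ (1 : ℝ))

/-- The coordinate functions `x̃₁(x) = −2x₂/θ` and `x̃₂(x) = 2x₁/θ`. -/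
def xt (θ : ℝ) : Fin 2 → E2 → ℝ := ![fun x => -2 * x 1 / θ, fun x => 2 * x 0 / θ]

/-- The harmonic Dirac operator `D_Ω Ψ = Σ_μ γ^μ(−i∂_μΨ) − Ω γ^{μ+2}(x̃_μ·Ψ)`, where
`γ μ` plays the role of `γ^{μ+1}` and `γ' μ` the role of `γ^{μ+3}`, for `μ : Fin 2`. -/
def DOmega (θ Ω : ℝ) (γ γ' : Fin 2 → Matrix (Fin 4) (Fin 4) ℂ) (Ψ : E2 → Fin 4 → ℂ) :
    E2 → Fin 4 → ℂ := fun x =>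
  ∑ μ : Fin 2, ((γ μ).mulVec ((-Complex.I) • pd μ Ψ x)
    - Ω • (γ' μ).mulVec (xt θ μ x • Ψ x))

open scoped SchwartzMap LineDeriv

/-- The oscillatory kernel `exp (-2i y·Θ⁻¹z)` of the Moyal product. -/
def moyalKernel (θ : ℝ) (y z : E2) : ℂ :=
  Complex.exp (-(2 * Complex.I) * ((((y 1) * (z 0) - (y 0) * (z 1)) / θ : ℝ) : ℂ))

lemma continuous_moyalKernel (θ : ℝ) : Continuous fun p : E2 × E2 => moyalKernel θ p.1 p.2 := by
  unfold moyalKernel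
  fun_prop

lemma norm_moyalKernel (θ : ℝ) (y z : E2) : ‖moyalKernel θ y z‖ = 1 := by
  rw [moyalKernel, Complex.norm_exp]
  simp

lemma moyalKernel_swap (θ : ℝ) (y z : E2) : moyalKernel (-θ) z y = moyalKernel θ y z := by
  unfold moyalKernel
  congr 3
  rw [div_neg, ← neg_div]
  ring

/-- The coordinate function `x̃_μ` as a continuous linear functional. -/
def xtCLM (θ : ℝ) : Fin 2 → E2 →L[ℝ] ℝ :=
  ![(-2 / θ) • EuclideanSpace.proj 1, (2 / θ) • EuclideanSpace.proj 0]

lemma coe_xtCLM (θ : ℝ) (μ : Fin 2) : ⇑(xtCLM θ μ) = xt θ μ := by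
  ext x
  fin_cases μ <;> simp [xtCLM, xt] <;> ring

lemma xt_add (θ : ℝ) (μ : Fin 2) (x y : E2) : xt θ μ (x + y) = xt θ μ x + xt θ μ y := by
  simp [← coe_xtCLM]

lemma xt_neg_param (θ : ℝ) (μ : Fin 2) (x : E2) : xt (-θ) μ x = -xt θ μ x := by
  fin_cases μ <;> simp [xt, div_neg]

/-- Multiplication of a Schwartz function by the coordinate function `x̃_μ`. -/
def xtMul (θ : ℝ) (μ : Fin 2) (f : 𝓢(E2, ℂ)) : 𝓢(E2, ℂ) :=
  SchwartzMap.smulLeftCLM ℂ (xtCLM θ μ) f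

lemma xtMul_apply (θ : ℝ) (μ : Fin 2) (f : 𝓢(E2, ℂ)) (x : E2) :
    xtMul θ μ f x = (xt θ μ x : ℂ) * f x := by
  rw [xtMul, SchwartzMap.smulLeftCLM_apply_apply (by fun_prop), coe_xtCLM, Complex.real_smul]

lemma xtMul_neg_param (θ : ℝ) (μ : Fin 2) (f : 𝓢(E2, ℂ)) : xtMul (-θ) μ f = -xtMul θ μ f := by
  ext x
  simp [xtMul_apply, xt_neg_param]

/-- The partial derivative `∂_μ` of a Schwartz function, as a Schwartz function. -/
def schwartzPd (μ : Fin 2) (f : 𝓢(E2, ℂ)) : 𝓢(E2, ℂ) :=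
  ∂_{EuclideanSpace.single μ (1 : ℝ)} f

lemma coe_schwartzPd (μ : Fin 2) (f : 𝓢(E2, ℂ)) : ⇑(schwartzPd μ f) = pd μ f := rfl

lemma integrable_moyal (θ : ℝ) (f g : 𝓢(E2, ℂ)) (x : E2) :
    Integrable (fun p : E2 × E2 => f (x + p.1) * g (x + p.2) * moyalKernel θ p.1 p.2) := by
  refine Integrable.mul_bdd (c := 1) ?_ (continuous_moyalKernel θ).aestronglyMeasurable
    (.of_forall fun p => (norm_moyalKernel θ p.1 p.2).le)
  exact (f.integrable.comp_add_left x).mul_prod (g.integrable.comp_add_left x)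

lemma moyal_eq_integral_prod (θ : ℝ) (f g : 𝓢(E2, ℂ)) (x : E2) :
    moyal θ f g x = (((Real.pi * θ) ^ 2)⁻¹ : ℝ) •
      ∫ p : E2 × E2, f (x + p.1) * g (x + p.2) * moyalKernel θ p.1 p.2 := by
  rw [Measure.volume_eq_prod, integral_prod _ (integrable_moyal θ f g x)]
  rfl

lemma moyal_eq_integral_sub (θ : ℝ) (f g : 𝓢(E2, ℂ)) (x : E2) :
    moyal θ f g x = (((Real.pi * θ) ^ 2)⁻¹ : ℝ) •
      ∫ p : E2 × E2, f p.1 * g p.2 * moyalKernel θ (p.1 - x) (p.2 - x) := by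
  rw [moyal_eq_integral_prod, Measure.volume_eq_prod, ← integral_add_left_eq_self
    (fun p : E2 × E2 => f p.1 * g p.2 * moyalKernel θ (p.1 - x) (p.2 - x)) (x, x)]
  simp

lemma moyal_swap (θ : ℝ) (f g : 𝓢(E2, ℂ)) (x : E2) : moyal (-θ) g f x = moyal θ f g x := by
  rw [moyal_eq_integral_prod, moyal_eq_integral_prod, Measure.volume_eq_prod,
    ← integral_prod_swap]
  simp only [Prod.fst_swap, Prod.snd_swap, moyalKernel_swap, mul_neg, neg_sq, mul_comm (g _)]

/-- For fixed `f` and `x`, the map `g ↦ (f ⋆ g) x` on Schwartz functions. -/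
def moyalRight (θ : ℝ) (f : 𝓢(E2, ℂ)) (x : E2) : 𝓢(E2, ℂ) →ₗ[ℂ] ℂ where
  toFun g := moyal θ f g x
  map_add' g h := by
    simp only [moyal_eq_integral_prod, add_apply, mul_add, add_mul]
    rw [integral_add (integrable_moyal θ f g x) (integrable_moyal θ f h x), smul_add]
  map_smul' c g := by
    simp only [moyal_eq_integral_prod, smul_apply, RingHom.id_apply]
    rw [smul_comm c, smul_eq_mul c, ← integral_const_mul]
    congr 2 with p
    ring

lemma hasFDerivAt_moyalKernel_left (θ : ℝ) (z y : E2) :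
    HasFDerivAt (fun y => moyalKernel θ y z)
      (moyalKernel θ y z • ((-(2 * Complex.I)) • Complex.ofRealCLM.comp
        (θ⁻¹ • (z 0 • EuclideanSpace.proj 1 - z 1 • EuclideanSpace.proj 0 : E2 →L[ℝ] ℝ)))) y := by
  have hfun (y : E2) : moyalKernel θ y z
      = Complex.exp (((-(2 * Complex.I)) • Complex.ofRealCLM.comp
        (θ⁻¹ • (z 0 • EuclideanSpace.proj 1 - z 1 • EuclideanSpace.proj 0 : E2 →L[ℝ] ℝ))) y) := by
    rw [moyalKernel]
    congr 1
    simp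
    ring
  simp only [hfun]
  exact (ContinuousLinearMap.hasFDerivAt _).cexp

lemma fderiv_moyalKernel_left (θ : ℝ) (μ : Fin 2) (y z : E2) :
    fderiv ℝ (fun y => moyalKernel θ y z) y (EuclideanSpace.single μ 1)
      = -Complex.I * xt θ μ z * moyalKernel θ y z := by
  rw [(hasFDerivAt_moyalKernel_left θ z y).fderiv]
  fin_cases μ <;> simp [xt] <;> ring

lemma integral_mul_moyalKernel (θ : ℝ) (μ : Fin 2) (f : 𝓢(E2, ℂ)) (x z : E2) :
    ∫ y, f (x + y) * moyalKernel θ y z * xt θ μ z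
      = -Complex.I * ∫ y, pd μ f (x + y) * moyalKernel θ y z := by
  have hint (h : 𝓢(E2, ℂ)) : Integrable (fun y => h (x + y) * moyalKernel θ y z) :=
    (h.integrable.comp_add_left x).mul_bdd (c := 1)
      ((continuous_moyalKernel θ).comp (by fun_prop : Continuous fun y => (y, z))
        |>.aestronglyMeasurable) (.of_forall fun y => (norm_moyalKernel θ y z).le)
  have hd (y : E2) : fderiv ℝ (fun y => f (x + y)) y (EuclideanSpace.single μ 1)
      = pd μ f (x + y) := by
    rw [fderiv_comp_add_left]; rfl
  have key := integral_mul_fderiv_eq_neg_fderiv_mul_of_integrable (𝕜 := ℂ) (μ := volume)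
    (f := fun y => f (x + y)) (g := fun y => moyalKernel θ y z)
    (v := EuclideanSpace.single μ (1 : ℝ))
    (by simpa only [hd, coe_schwartzPd] using hint (schwartzPd μ f))
    (by
      simp only [fderiv_moyalKernel_left]
      exact ((hint f).const_mul (-Complex.I * xt θ μ z)).congr (.of_forall fun y => by ring))
    (hint f)
    (fun y _ => (f.differentiableAt).comp y (by fun_prop))
    (fun y _ => (hasFDerivAt_moyalKernel_left θ z y).differentiableAt)
  simp only [hd, fderiv_moyalKernel_left] at key
  calc ∫ y, f (x + y) * moyalKernel θ y z * xt θ μ z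
      = Complex.I * ∫ y, f (x + y) * (-Complex.I * xt θ μ z * moyalKernel θ y z) := by
        rw [← integral_const_mul]
        congr 1 with y
        linear_combination (f (x + y) * moyalKernel θ y z * xt θ μ z) * Complex.I_mul_I
    _ = _ := by rw [key]; ring

lemma moyal_xtMul_right (θ : ℝ) (μ : Fin 2) (f g : 𝓢(E2, ℂ)) (x : E2) :
    moyal θ f (xtMul θ μ g) x
      = xt θ μ x * moyal θ f g x - Complex.I * moyal θ (pd μ f) g x := by
  have h1 := integrable_moyal θ f (xtMul θ μ g) x
  have h2 := (integrable_moyal θ f g x).const_mul (xt θ μ x : ℂ)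
  have key : (∫ p : E2 × E2, f (x + p.1) * xtMul θ μ g (x + p.2) * moyalKernel θ p.1 p.2)
      - ∫ p : E2 × E2, xt θ μ x * (f (x + p.1) * g (x + p.2) * moyalKernel θ p.1 p.2)
      = -Complex.I *
        ∫ p : E2 × E2, pd μ f (x + p.1) * g (x + p.2) * moyalKernel θ p.1 p.2 := by
    rw [← integral_sub h1 h2]
    have h3 := integrable_moyal θ (schwartzPd μ f) g x
    rw [coe_schwartzPd] at h3
    have h12 : Integrable fun p : E2 × E2 =>
        f (x + p.1) * xtMul θ μ g (x + p.2) * moyalKernel θ p.1 p.2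
          - xt θ μ x * (f (x + p.1) * g (x + p.2) * moyalKernel θ p.1 p.2) := h1.sub h2
    rw [Measure.volume_eq_prod] at h12 h3 ⊢
    rw [integral_prod_symm _ h12, integral_prod_symm _ h3, ← integral_const_mul]
    congr 1 with z
    calc _ = g (x + z) * ∫ y, f (x + y) * moyalKernel θ y z * xt θ μ z := by
          rw [← integral_const_mul]
          congr 1 with y
          simp only [xtMul_apply, xt_add]
          push_cast
          ring
      _ = _ := by
          rw [integral_mul_moyalKernel, mul_left_comm, ← integral_const_mul]
          congr 2 with y
          ring
  rw [integral_const_mul] at key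
  have h3 := moyal_eq_integral_prod θ (schwartzPd μ f) g x
  rw [coe_schwartzPd] at h3
  rw [moyal_eq_integral_prod, moyal_eq_integral_prod, h3]
  simp only [Complex.real_smul]
  linear_combination (((Real.pi * θ) ^ 2)⁻¹ : ℝ) * key

lemma moyal_xtMul_left (θ : ℝ) (μ : Fin 2) (f g : 𝓢(E2, ℂ)) (x : E2) :
    moyal θ (xtMul θ μ f) g x
      = xt θ μ x * moyal θ f g x + Complex.I * moyal θ f (pd μ g) x := by
  have h := moyal_xtMul_right (-θ) μ g f x
  have hneg : moyal (-θ) g (xtMul (-θ) μ f) x = -moyal (-θ) g (xtMul θ μ f) x := by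
    rw [xtMul_neg_param]
    exact map_neg (moyalRight (-θ) g x) _
  rw [hneg, moyal_swap, moyal_swap, ← coe_schwartzPd, moyal_swap, xt_neg_param] at h
  rw [← coe_schwartzPd]
  push_cast at h
  linear_combination -h

/-- The derivative in `x` of the exponent of `moyalKernel θ (y - x) (z - x)`, with `w = z - y`. -/
def moyalPhaseCLM (θ : ℝ) (w : E2) : E2 →L[ℝ] ℂ :=
  Complex.I • Complex.ofRealCLM.comp
    (xt θ 0 w • EuclideanSpace.proj 0 + xt θ 1 w • EuclideanSpace.proj 1 : E2 →L[ℝ] ℝ)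

lemma moyalPhaseCLM_single (θ : ℝ) (w : E2) (μ : Fin 2) :
    moyalPhaseCLM θ w (EuclideanSpace.single μ 1) = Complex.I * xt θ μ w := by
  fin_cases μ <;> simp [moyalPhaseCLM]

lemma continuous_moyalPhaseCLM (θ : ℝ) : Continuous (moyalPhaseCLM θ) := by
  unfold moyalPhaseCLM
  simp only [← coe_xtCLM]
  fun_prop

lemma norm_moyalPhaseCLM_le (θ : ℝ) (w : E2) :
    ‖moyalPhaseCLM θ w‖ ≤ |xt θ 0 w| + |xt θ 1 w| := by
  refine ContinuousLinearMap.opNorm_le_bound _ (by positivity) fun v => ?_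
  simp only [moyalPhaseCLM, smul_apply, ContinuousLinearMap.comp_apply,
    add_apply, norm_smul, Complex.norm_I, one_mul, Complex.ofRealCLM_apply,
    Complex.norm_real, PiLp.proj_apply, add_mul]
  refine (norm_add_le _ _).trans ?_
  simp only [norm_smul]
  gcongr
  · rfl
  · exact PiLp.norm_apply_le v 0
  · rfl
  · exact PiLp.norm_apply_le v 1

lemma hasFDerivAt_moyalKernel_sub (θ : ℝ) (y z x : E2) :
    HasFDerivAt (fun x => moyalKernel θ (y - x) (z - x))
      (moyalKernel θ (y - x) (z - x) • moyalPhaseCLM θ (z - y)) x := by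
  have hfun (x : E2) : moyalKernel θ (y - x) (z - x)
      = Complex.exp (moyalPhaseCLM θ (z - y) x
        + (-(2 * Complex.I) * ((y 1 * z 0 - y 0 * z 1) / θ : ℝ))) := by
    rw [moyalKernel]
    congr 1
    simp [moyalPhaseCLM, xt]
    ring
  simp only [hfun]
  exact ((moyalPhaseCLM θ (z - y)).hasFDerivAt.add_const _).cexp

lemma hasFDerivAt_moyal (θ : ℝ) (f g : 𝓢(E2, ℂ)) (x : E2) :
    ∃ L : E2 →L[ℝ] ℂ, HasFDerivAt (moyal θ f g) L x ∧ ∀ μ : Fin 2,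
      L (EuclideanSpace.single μ 1) = moyal θ (pd μ f) g x + moyal θ f (pd μ g) x := by
  set F : E2 → E2 × E2 → ℂ := fun x p =>
    f p.1 * g p.2 * moyalKernel θ (p.1 - x) (p.2 - x)
  set F' : E2 → E2 × E2 → (E2 →L[ℝ] ℂ) := fun x p =>
    (f p.1 * g p.2) • (moyalKernel θ (p.1 - x) (p.2 - x) • moyalPhaseCLM θ (p.2 - p.1)) with hF'
  have hK (x : E2) : Continuous fun p : E2 × E2 => moyalKernel θ (p.1 - x) (p.2 - x) :=
    (continuous_moyalKernel θ).comp (by fun_prop : Continuous fun p : E2 × E2 => (p.1 - x, p.2 - x))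
  have hfg : Continuous fun p : E2 × E2 => f p.1 * g p.2 :=
    (f.continuous.comp continuous_fst).mul (g.continuous.comp continuous_snd)
  have hFc (x : E2) : Continuous (F x) := hfg.mul (hK x)
  have hFc' (x : E2) : Continuous (F' x) :=
    hfg.smul ((hK x).smul ((continuous_moyalPhaseCLM θ).comp (by fun_prop)))
  have hint (f g : 𝓢(E2, ℂ)) : Integrable
      (fun p : E2 × E2 => f p.1 * g p.2 * moyalKernel θ (p.1 - x) (p.2 - x)) :=
    (f.integrable.mul_prod g.integrable).mul_bdd (c := 1) (hK x).aestronglyMeasurable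
      (.of_forall fun p => (norm_moyalKernel θ _ _).le)
  set bound : E2 × E2 → ℝ := fun p => ∑ μ : Fin 2,
    (‖f p.1‖ * ‖xtMul θ μ g p.2‖ + ‖xtMul θ μ f p.1‖ * ‖g p.2‖) with hb
  have hbint : Integrable bound := by
    refine integrable_finsetSum _ fun μ _ => ?_
    exact (f.integrable.norm.mul_prod (xtMul θ μ g).integrable.norm).add
      ((xtMul θ μ f).integrable.norm.mul_prod g.integrable.norm)
  have hle (x : E2) (p : E2 × E2) : ‖F' x p‖ ≤ bound p := by
    have hsub (μ : Fin 2) : |xt θ μ (p.2 - p.1)| ≤ |xt θ μ p.2| + |xt θ μ p.1| := by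
      rw [← coe_xtCLM, map_sub]
      exact abs_sub _ _
    have := (norm_moyalPhaseCLM_le θ (p.2 - p.1)).trans (add_le_add (hsub 0) (hsub 1))
    simp only [hF', hb, norm_smul, norm_mul, norm_moyalKernel, one_mul, xtMul_apply,
      Complex.norm_real, Real.norm_eq_abs, Fin.sum_univ_two]
    refine (mul_le_mul_of_nonneg_left this (by positivity)).trans_eq ?_
    ring
  have hderiv := hasFDerivAt_integral_of_dominated_of_fderiv_le (𝕜 := ℝ) (F := F) (F' := F')
    (x₀ := x) (bound := bound) (μ := volume) Filter.univ_mem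
    (.of_forall fun x => (hFc x).aestronglyMeasurable) (hint f g)
    (hFc' x).aestronglyMeasurable (.of_forall fun p x _ => hle x p) hbint
    (.of_forall fun p x _ => (hasFDerivAt_moyalKernel_sub θ p.1 p.2 x).const_mul (f p.1 * g p.2))
  have hF'int : Integrable (F' x) :=
    hbint.mono' (hFc' x).aestronglyMeasurable (.of_forall (hle x))
  refine ⟨_, (hderiv.const_smul (((Real.pi * θ) ^ 2)⁻¹ : ℝ)).congr_of_eventuallyEq
    (.of_forall fun x => moyal_eq_integral_sub θ f g x), fun μ => ?_⟩
  have key : (((Real.pi * θ) ^ 2)⁻¹ : ℝ) • ∫ p, F' x p (EuclideanSpace.single μ 1)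
      = Complex.I * (moyal θ f (xtMul θ μ g) x - moyal θ (xtMul θ μ f) g x) := by
    rw [moyal_eq_integral_sub, moyal_eq_integral_sub, ← smul_sub, ← integral_sub (hint _ _)
      (hint _ _), mul_smul_comm, ← integral_const_mul]
    congr 2 with p
    simp only [hF', smul_apply, moyalPhaseCLM_single, smul_eq_mul, xtMul_apply]
    rw [← coe_xtCLM, map_sub]
    push_cast
    ring
  rw [smul_apply, ContinuousLinearMap.integral_apply hF'int, key,
    moyal_xtMul_right, moyal_xtMul_left]
  linear_combination (-moyal θ (pd μ f) g x - moyal θ f (pd μ g) x) * Complex.I_mul_I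

/-- For arbitrary 4×4 matrices γ¹,…,γ⁴ and Ω ∈ (0,1], the commutator of the harmonic
Dirac operator with left Moyal multiplication:
`D_Ω(a ⋆ Ψ) − a ⋆ (D_Ω Ψ) = −i Σ_μ (γ^μ + Ωγ^{μ+2})((∂_μ a) ⋆ Ψ)`. -/
theorem DOmega_commutator (θ : ℝ) (hθ : 0 < θ) (Ω : ℝ) (hΩ : Ω ∈ Set.Ioc (0:ℝ) 1)
    (γ γ' : Fin 2 → Matrix (Fin 4) (Fin 4) ℂ)
    (a : SchwartzMap E2 ℂ) (Ψ : SchwartzMap E2 (Fin 4 → ℂ)) :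
    ∀ x : E2, DOmega θ Ω γ γ' (moyalV θ (⇑a) (⇑Ψ)) x
        - moyalV θ (⇑a) (DOmega θ Ω γ γ' (⇑Ψ)) x
      = (-Complex.I) • ∑ μ : Fin 2,
          (γ μ + Ω • γ' μ).mulVec (moyalV θ (pd μ (⇑a)) (⇑Ψ) x) := by
  intro x
  set ψ : Fin 4 → 𝓢(E2, ℂ) := fun j =>
    Ψ.postcompCLM (ContinuousLinearMap.proj j : (Fin 4 → ℂ) →L[ℂ] ℂ)
  have hψ_apply (j : Fin 4) (y : E2) : Ψ y j = ψ j y := rfl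
  have hpdΨ (μ : Fin 2) (y : E2) (j : Fin 4) : pd μ Ψ y j = pd μ (ψ j) y := by
    have h := hasFDerivAt_pi'.mp (Ψ.hasFDerivAt y) j
    exact congrArg (· (EuclideanSpace.single μ 1)) h.fderiv.symm
  have hpd_moyal (μ : Fin 2) (j : Fin 4) : pd μ (moyalV θ a Ψ) x j
      = moyal θ (pd μ a) (ψ j) x + moyal θ a (pd μ (ψ j)) x := by
    choose L hL hLμ using fun j => hasFDerivAt_moyal θ a (ψ j) x
    have h : HasFDerivAt (moyalV θ a Ψ) (ContinuousLinearMap.pi L) x := hasFDerivAt_pi.mpr hL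
    rw [pd, h.fderiv, ContinuousLinearMap.pi_apply, hLμ]
  ext i
  have hD : (fun y => DOmega θ Ω γ γ' Ψ y i)
      = ⇑(∑ μ : Fin 2, ∑ j : Fin 4,
        ((-Complex.I * γ μ i j) • schwartzPd μ (ψ j)
          - (Ω * γ' μ i j) • xtMul θ μ (ψ j))) := by
    ext y
    simp only [DOmega, Matrix.mulVec, dotProduct, Finset.sum_apply, Pi.sub_apply, Pi.smul_apply,
      hpdΨ, hψ_apply, smul_eq_mul, Complex.real_smul, sum_apply,
      sub_apply, smul_apply, xtMul_apply, coe_schwartzPd,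
      Finset.mul_sum, ← Finset.sum_sub_distrib]
    congr! 2
    ring
  have hmoyalD : moyalV θ a (DOmega θ Ω γ γ' Ψ) x i = ∑ μ : Fin 2, ∑ j : Fin 4,
      (-Complex.I * γ μ i j * moyal θ a (pd μ (ψ j)) x
        - Ω * γ' μ i j * (xt θ μ x * moyal θ a (ψ j) x
          - Complex.I * moyal θ (pd μ a) (ψ j) x)) := by
    rw [moyalV, hD]
    change moyalRight θ a x _ = _
    simp only [map_sum, map_sub, map_smul, smul_eq_mul]
    simp only [moyalRight, LinearMap.coe_mk, AddHom.coe_mk, moyal_xtMul_right,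
      coe_schwartzPd]
  rw [Pi.sub_apply, hmoyalD]
  simp only [DOmega, Matrix.mulVec, dotProduct, Finset.sum_apply, Pi.sub_apply, Pi.smul_apply,
    hpd_moyal, smul_eq_mul, Complex.real_smul, Finset.mul_sum, ← Finset.sum_sub_distrib,
    Matrix.add_apply, Matrix.smul_apply]
  congr! 2 with μ _ j _
  change _ * (_ * _) - _ * (_ * (_ * moyal θ a (ψ j) x)) - _
    = _ * (_ * moyal θ (pd μ a) (ψ j) x)
  ring

end
end

section
/- Let γ¹, γ², γ³, γ⁴ be Hermitian complex 4×4 matrices satisfying the Clifford relations γ^μγ^ν + γ^νγ^μ = 2δ^{μν}·I₄, γ^{μ+2}γ^{ν+2} + γ^{ν+2}γ^{μ+2} = 2δ^{μν}·I₄ and γ^μγ^{ν+2} + γ^{ν+2}γ^μ = 0 for μ,ν ∈ {1,2}. Let Ω ∈ (0,1] and define D_Ω on Schwartz functions Ψ : ℝ² → ℂ⁴ by D_Ω Ψ := Σ_{μ=1,2} γ^μ(−i ∂_μ Ψ) − Ω γ^{μ+2}(x̃_μ·Ψ). Then the Dirac operator squares to the harmonic oscillator Hamiltonian up to a constant matrix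 term: for every Schwartz Ψ : ℝ² → ℂ⁴ and x ∈ ℝ², D_Ω(D_Ω Ψ)(x) = −(∂₁²Ψ + ∂₂²Ψ)(x) + Ω²(4|x|²/θ²)Ψ(x) + (2iΩ/θ)(γ¹γ⁴ − γ²γ³)Ψ(x). -/
open MeasureTheory Complex

noncomputable section

theorem pd_sub {V : Type*} [NormedAddCommGroup V] [NormedSpace ℝ V] (μ : Fin 2) {f g : E2 → V}
    {x : E2} (hf : DifferentiableAt ℝ f x) (hg : DifferentiableAt ℝ g x) :
    pd μ (fun y => f y - g y) x = pd μ f x - pd μ g x := by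
  simp [pd, fderiv_fun_sub hf hg]

theorem pd_add {V : Type*} [NormedAddCommGroup V] [NormedSpace ℝ V] (μ : Fin 2) {f g : E2 → V}
    {x : E2} (hf : DifferentiableAt ℝ f x) (hg : DifferentiableAt ℝ g x) :
    pd μ (fun y => f y + g y) x = pd μ f x + pd μ g x := by
  simp [pd, fderiv_fun_add hf hg]

theorem pd_const_smul {R V : Type*} [NormedAddCommGroup V] [NormedSpace ℝ V] [Semiring R]
    [Module R V] [SMulCommClass ℝ R V] [ContinuousConstSMul R V] (μ : Fin 2) {f : E2 → V} {x : E2}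
    (c : R) (hf : DifferentiableAt ℝ f x) :
    pd μ (fun y => c • f y) x = c • pd μ f x := by
  simp [pd, fderiv_fun_const_smul hf c]

theorem pd_smul {V : Type*} [NormedAddCommGroup V] [NormedSpace ℝ V] (μ : Fin 2) {c : E2 → ℝ}
    {f : E2 → V} {x : E2} (hc : DifferentiableAt ℝ c x) (hf : DifferentiableAt ℝ f x) :
    pd μ (fun y => c y • f y) x = c x • pd μ f x + pd μ c x • f x := by
  simp [pd, fderiv_fun_smul hc hf]

theorem hasFDerivAt_mulVec {m n : Type*} [Fintype m] [Fintype n] {f : E2 → n → ℂ}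
    {f' : E2 →L[ℝ] n → ℂ} {x : E2} (M : Matrix m n ℂ) (hf : HasFDerivAt f f' x) :
    HasFDerivAt (fun y => M.mulVec (f y))
      ((LinearMap.toContinuousLinearMap (M.mulVecLin.restrictScalars ℝ)).comp f') x :=
  (LinearMap.toContinuousLinearMap (M.mulVecLin.restrictScalars ℝ)).hasFDerivAt.comp x hf

theorem differentiableAt_mulVec {m n : Type*} [Fintype m] [Fintype n] {f : E2 → n → ℂ}
    {x : E2} (M : Matrix m n ℂ) (hf : DifferentiableAt ℝ f x) :
    DifferentiableAt ℝ (fun y => M.mulVec (f y)) x :=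
  (hasFDerivAt_mulVec M hf.hasFDerivAt).differentiableAt

theorem pd_mulVec {m n : Type*} [Fintype m] [Fintype n] (μ : Fin 2) {f : E2 → n → ℂ} {x : E2}
    (M : Matrix m n ℂ) (hf : DifferentiableAt ℝ f x) :
    pd μ (fun y => M.mulVec (f y)) x = M.mulVec (pd μ f x) := by
  simp [pd, (hasFDerivAt_mulVec M hf.hasFDerivAt).fderiv]

theorem contDiff_pd {V : Type*} [NormedAddCommGroup V] [NormedSpace ℝ V] (μ : Fin 2)
    {f : E2 → V} {n : ℕ} (hf : ContDiff ℝ (n + 1) f) : ContDiff ℝ n (pd μ f) :=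
  (hf.fderiv_right le_rfl).clm_apply contDiff_const

theorem pd_comm {V : Type*} [NormedAddCommGroup V] [NormedSpace ℝ V] (μ ν : Fin 2)
    {f : E2 → V} (hf : ContDiff ℝ 2 f) (x : E2) : pd μ (pd ν f) x = pd ν (pd μ f) x := by
  have hd : DifferentiableAt ℝ (fderiv ℝ f) x :=
    (hf.fderiv_right (m := 1) (by norm_num)).differentiable (by norm_num) x
  have hpd (κ ι : Fin 2) : pd κ (pd ι f) x
      = fderiv ℝ (fderiv ℝ f) x (EuclideanSpace.single κ 1) (EuclideanSpace.single ι 1) := by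
    unfold pd
    rw [fderiv_clm_apply hd (differentiableAt_const _)]
    simp
  rw [hpd, hpd]
  exact (hf.contDiffAt.isSymmSndFDerivAt (by simp)).eq _ _

theorem pd_coord (μ ν : Fin 2) (x : E2) :
    pd μ (fun y : E2 => y ν) x = if μ = ν then 1 else 0 := by
  have h : HasFDerivAt (fun y : E2 => y ν) (EuclideanSpace.proj ν : E2 →L[ℝ] ℝ) x :=
    (EuclideanSpace.proj ν : E2 →L[ℝ] ℝ).hasFDerivAt
  simp [pd, h.fderiv, eq_comm]

theorem xt_eq_const_smul (θ : ℝ) :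
    xt θ 0 = (fun x : E2 => (-2 / θ) • x 1) ∧ xt θ 1 = (fun x : E2 => (2 / θ) • x 0) := by
  constructor <;> funext x <;> simp [xt] <;> ring

theorem differentiable_xt (θ : ℝ) (μ : Fin 2) : Differentiable ℝ (xt θ μ) := by
  have h := xt_eq_const_smul θ
  fin_cases μ
  · simp only [Fin.zero_eta, h.1]; fun_prop
  · simp only [Fin.mk_one, h.2]; fun_prop

theorem pd_xt (θ : ℝ) (μ ν : Fin 2) (x : E2) :
    pd μ (xt θ ν) x = !![0, 2 / θ; -2 / θ, 0] μ ν := by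
  have h := xt_eq_const_smul θ
  have hd (κ : Fin 2) : DifferentiableAt ℝ (fun y : E2 => y κ) x := by fun_prop
  fin_cases ν
  · simp only [Fin.zero_eta, h.1, pd_const_smul μ _ (hd 1), pd_coord]
    fin_cases μ <;> simp
  · simp only [Fin.mk_one, h.2, pd_const_smul μ _ (hd 0), pd_coord]
    fin_cases μ <;> simp

theorem pd_DOmega (θ Ω : ℝ) (γ γ' : Fin 2 → Matrix (Fin 4) (Fin 4) ℂ) {Ψ : E2 → Fin 4 → ℂ}
    (hΨ : ContDiff ℝ 2 Ψ) (ν : Fin 2) (x : E2) :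
    pd ν (DOmega θ Ω γ γ' Ψ) x
      = ∑ μ : Fin 2, ((γ μ).mulVec ((-Complex.I) • pd ν (pd μ Ψ) x)
        - Ω • (γ' μ).mulVec (xt θ μ x • pd ν Ψ x + pd ν (xt θ μ) x • Ψ x)) := by
  have hΨd : DifferentiableAt ℝ Ψ x := hΨ.differentiable (by norm_num) x
  have hpd (μ : Fin 2) : DifferentiableAt ℝ (pd μ Ψ) x :=
    (contDiff_pd (n := 1) μ (by exact_mod_cast hΨ)).differentiable (by norm_num) x
  have hx (μ : Fin 2) : DifferentiableAt ℝ (xt θ μ) x := differentiable_xt θ μ x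
  have hI (μ : Fin 2) : DifferentiableAt ℝ (fun y => (-Complex.I) • pd μ Ψ y) x :=
    (hpd μ).fun_const_smul _
  have hxΨ (μ : Fin 2) : DifferentiableAt ℝ (fun y => xt θ μ y • Ψ y) x := (hx μ).smul hΨd
  have hA (μ : Fin 2) := differentiableAt_mulVec (γ μ) (hI μ)
  have hB (μ : Fin 2) := differentiableAt_mulVec (γ' μ) (hxΨ μ)
  have hC (μ : Fin 2) := (hB μ).fun_const_smul Ω
  have hS (μ : Fin 2) := (hA μ).fun_sub (hC μ)
  unfold DOmega
  simp only [Fin.sum_univ_two]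
  rw [pd_add ν (hS 0) (hS 1)]
  simp only [pd_sub ν (hA _) (hC _), pd_const_smul ν Ω (hB _), pd_mulVec ν _ (hI _),
    pd_mulVec ν _ (hxΨ _), pd_const_smul ν _ (hpd _), pd_smul ν (hx _) hΨd]

/-- If γ¹,…,γ⁴ are Hermitian and satisfy the Clifford relations of ℂl(4), then the
harmonic Dirac operator squares to the harmonic oscillator Hamiltonian up to a constant
matrix term: `D_Ω²Ψ = −ΔΨ + Ω²(4|x|²/θ²)Ψ + (2iΩ/θ)(γ¹γ⁴ − γ²γ³)Ψ`. -/
theorem DOmega_sq (θ : ℝ) (hθ : 0 < θ) (Ω : ℝ) (hΩ : Ω ∈ Set.Ioc (0:ℝ) 1)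
    (γ γ' : Fin 2 → Matrix (Fin 4) (Fin 4) ℂ)
    (hherm : ∀ μ, (γ μ).IsHermitian) (hherm' : ∀ μ, (γ' μ).IsHermitian)
    (hcl : ∀ μ ν, γ μ * γ ν + γ ν * γ μ = ((2 : ℂ) * if μ = ν then 1 else 0) • 1)
    (hcl' : ∀ μ ν, γ' μ * γ' ν + γ' ν * γ' μ = ((2 : ℂ) * if μ = ν then 1 else 0) • 1)
    (hanti : ∀ μ ν, γ μ * γ' ν + γ' ν * γ μ = 0)
    (Ψ : SchwartzMap E2 (Fin 4 → ℂ)) :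
    ∀ x : E2, DOmega θ Ω γ γ' (DOmega θ Ω γ γ' (⇑Ψ)) x
      = -(pd 0 (pd 0 (⇑Ψ)) x + pd 1 (pd 1 (⇑Ψ)) x)
        + (Ω ^ 2 * (4 * ‖x‖ ^ 2 / θ ^ 2)) • Ψ x
        + ((2 * Complex.I * Ω) / θ) • (γ 0 * γ' 1 - γ 1 * γ' 0).mulVec (Ψ x) := by
  intro x
  have hΨ : ContDiff ℝ 2 (⇑Ψ) := Ψ.smooth 2
  have hsq {M : Matrix (Fin 4) (Fin 4) ℂ} (h : M * M + M * M = (2 : ℂ) • 1) : M * M = 1 := by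
    rw [← two_smul ℂ] at h
    exact smul_right_injective _ (two_ne_zero : (2 : ℂ) ≠ 0) h
  have h00 : γ 0 * γ 0 = 1 := hsq (by simpa using hcl 0 0)
  have h11 : γ 1 * γ 1 = 1 := hsq (by simpa using hcl 1 1)
  have h00' : γ' 0 * γ' 0 = 1 := hsq (by simpa using hcl' 0 0)
  have h11' : γ' 1 * γ' 1 = 1 := hsq (by simpa using hcl' 1 1)
  have h10 : γ 1 * γ 0 = -(γ 0 * γ 1) := eq_neg_of_add_eq_zero_left (by simpa using hcl 1 0)
  have h10' : γ' 1 * γ' 0 = -(γ' 0 * γ' 1) := eq_neg_of_add_eq_zero_left (by simpa using hcl' 1 0)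
  have hc (μ ν : Fin 2) : γ' ν * γ μ = -(γ μ * γ' ν) := eq_neg_of_add_eq_zero_right (hanti μ ν)
  have hnorm : ‖x‖ ^ 2 = x 0 ^ 2 + x 1 ^ 2 := by
    simp [EuclideanSpace.norm_sq_eq, Fin.sum_univ_two]
  have hI2 : Complex.I ^ 2 = -1 := Complex.I_sq
  have hθ' : (θ : ℂ) ≠ 0 := by exact_mod_cast hθ.ne'
  rw [DOmega]
  simp only [pd_DOmega θ Ω γ γ' hΨ, pd_xt, hnorm]
  simp only [DOmega, Fin.sum_univ_two, Matrix.mulVec_add, Matrix.mulVec_sub, Matrix.mulVec_smul,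
    Matrix.mulVec_mulVec, smul_add, smul_sub, h00, h11, h00', h11', h10, h10', hc,
    Matrix.neg_mulVec, Matrix.sub_mulVec, Matrix.one_mulVec]
  funext i
  simp only [xt, Matrix.cons_val_zero, Matrix.cons_val_one]
  simp
  field_simp
  ring_nf
  rw [hI2, pd_comm 1 0 hΨ x]
  ring

end
end

section
/- Let H be a complex Hilbert space, L and L̄ bounded linear operators on H, and Ω ∈ ℝ. Define the bounded operator M on the Hilbert space direct sum H⁴ = H ⊕ H ⊕ H ⊕ H by M(ψ₁,ψ₂,ψ₃,ψ₄) := (L̄ψ₂ + Ω L̄ψ₃, Lψ₁ − Ω L̄ψ₄, Ω Lψ₁ + L̄ψ₄, −Ω Lψ₂ + Lψ₃). Then the operator norm of M equals √(1+Ω²) · max(‖L‖, ‖L̄‖). -/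
noncomputable section

/-- The matrix `!![1, -Ω; Ω, 1]` scales the norm of a direct sum by `√(1 + Ω ^ 2)`. -/
theorem norm_sub_smul_sq_add_norm_smul_add_sq {E : Type*} [NormedAddCommGroup E]
    [InnerProductSpace ℂ E] (Ω : ℝ) (a b : E) :
    ‖a - Ω • b‖ ^ 2 + ‖Ω • a + b‖ ^ 2 = (1 + Ω ^ 2) * (‖a‖ ^ 2 + ‖b‖ ^ 2) := by
  let : InnerProductSpace ℝ E := InnerProductSpace.complexToReal
  rw [norm_sub_sq_real, norm_add_sq_real, real_inner_smul_left, real_inner_smul_right,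
    norm_smul, norm_smul, mul_pow, mul_pow, Real.norm_eq_abs, sq_abs]
  ring

/-- Operator-matrix computation: if `M` acts on the Hilbert space direct sum `H⁴` by
`M(ψ₁,ψ₂,ψ₃,ψ₄) = (L̄ψ₂ + ΩL̄ψ₃, Lψ₁ − ΩL̄ψ₄, ΩLψ₁ + L̄ψ₄, −ΩLψ₂ + Lψ₃)`, then
`‖M‖ = √(1+Ω²)·max(‖L‖, ‖L̄‖)`. -/
theorem opNorm_harmonic_matrix {H : Type*} [NormedAddCommGroup H]
    [InnerProductSpace ℂ H] [CompleteSpace H]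
    (L Lbar : H →L[ℂ] H) (Ω : ℝ)
    (M : PiLp 2 (fun _ : Fin 4 => H) →L[ℂ] PiLp 2 (fun _ : Fin 4 => H))
    (hM : ∀ ψ : PiLp 2 (fun _ : Fin 4 => H),
      M ψ 0 = Lbar (ψ 1) + Ω • Lbar (ψ 2) ∧
      M ψ 1 = L (ψ 0) - Ω • Lbar (ψ 3) ∧
      M ψ 2 = Ω • L (ψ 0) + Lbar (ψ 3) ∧
      M ψ 3 = -(Ω • L (ψ 1)) + L (ψ 2)) :
    ‖M‖ = Real.sqrt (1 + Ω ^ 2) * max ‖L‖ ‖Lbar‖ := by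
  set m := max ‖L‖ ‖Lbar‖
  have hm : 0 ≤ m := le_max_of_le_left (norm_nonneg L)
  have hL (x : H) : ‖L x‖ ^ 2 ≤ m ^ 2 * ‖x‖ ^ 2 := by
    rw [← mul_pow]
    gcongr
    exact L.le_of_opNorm_le (le_max_left _ _) x
  have hLbar (x : H) : ‖Lbar x‖ ^ 2 ≤ m ^ 2 * ‖x‖ ^ 2 := by
    rw [← mul_pow]
    gcongr
    exact Lbar.le_of_opNorm_le (le_max_right _ _) x
  have hs : Real.sqrt (1 + Ω ^ 2) ^ 2 = 1 + Ω ^ 2 := Real.sq_sqrt (by positivity)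
  have hs_pos : 0 < Real.sqrt (1 + Ω ^ 2) := Real.sqrt_pos.2 (by positivity)
  have hsq (ψ : PiLp 2 (fun _ : Fin 4 => H)) :
      ‖M ψ‖ ^ 2 = (1 + Ω ^ 2) * (‖L (ψ 0)‖ ^ 2 + ‖Lbar (ψ 3)‖ ^ 2) +
        (‖Lbar (Ω • ψ 2 + ψ 1)‖ ^ 2 + ‖L (ψ 2 - Ω • ψ 1)‖ ^ 2) := by
    obtain ⟨h0, h1, h2, h3⟩ := hM ψ
    have e0 : M ψ 0 = Lbar (Ω • ψ 2 + ψ 1) := by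
      rw [h0, map_add, ContinuousLinearMap.map_smul_of_tower, add_comm]
    have e3 : M ψ 3 = L (ψ 2 - Ω • ψ 1) := by
      rw [h3, map_sub, ContinuousLinearMap.map_smul_of_tower, neg_add_eq_sub]
    rw [PiLp.norm_sq_eq_of_L2, Fin.sum_univ_four, e0, h1, h2, e3,
      ← norm_sub_smul_sq_add_norm_smul_add_sq]
    ring
  have hsingle (i : Fin 4) (x : H) :
      ‖M (PiLp.single 2 i x)‖ ^ 2 ≤ (‖M‖ * ‖x‖) ^ 2 := by
    gcongr
    simpa using M.le_opNorm (PiLp.single 2 i x)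
  apply le_antisymm
  · refine M.opNorm_le_bound (by positivity) fun ψ => ?_
    refine le_of_sq_le_sq ?_ (by positivity)
    rw [hsq, mul_pow, mul_pow, hs, PiLp.norm_sq_eq_of_L2, Fin.sum_univ_four]
    calc
      _ ≤ (1 + Ω ^ 2) * (m ^ 2 * ‖ψ 0‖ ^ 2 + m ^ 2 * ‖ψ 3‖ ^ 2) +
          (m ^ 2 * ‖Ω • ψ 2 + ψ 1‖ ^ 2 + m ^ 2 * ‖ψ 2 - Ω • ψ 1‖ ^ 2) := by
        gcongr <;> first | exact hL _ | exact hLbar _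
      _ = _ := by
        linear_combination m ^ 2 * norm_sub_smul_sq_add_norm_smul_add_sq (E := H) Ω (ψ 2) (ψ 1)
  · rw [mul_comm, ← le_div_iff₀ hs_pos]
    refine max_le (L.opNorm_le_bound (by positivity) fun x => ?_)
      (Lbar.opNorm_le_bound (by positivity) fun x => ?_)
    all_goals
      rw [div_mul_eq_mul_div, le_div_iff₀ hs_pos]
      refine le_of_sq_le_sq ?_ (by positivity)
      rw [mul_pow, hs]
    · simpa [hsq, mul_comm] using hsingle 0 x
    · simpa [hsq, mul_comm] using hsingle 3 x

end
end

section
/- For every θ > 0 and all Schwartz functions a, ψ : ℝ² → ℂ, the left Moyal multiplication operator is an integral operator with kernel K_{L(a)}(x,y) := (πθ)⁻² ∫_{ℝ²} a(x+z) e^{2i z·Θ⁻¹(x−y)} dz: for every x ∈ ℝ², (a ⋆ ψ)(x) = ∫_{ℝ²} K_{L(a)}(x,y) ψ(y) dy, and the integrals involved converge absolutely. -/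
open MeasureTheory Complex

noncomputable section

/-- The integral kernel of the left Moyal multiplication operator `L(a)`:
`K_{L(a)}(x,y) = (πθ)⁻² ∫ a(x+z) e^{2i z·Θ⁻¹(x−y)} dz` with
`z·Θ⁻¹w = (z₂w₁ − z₁w₂)/θ`. -/
def KLa (θ : ℝ) (a : E2 → ℂ) (x y : E2) : ℂ :=
  (((Real.pi * θ) ^ 2)⁻¹ : ℝ) • ∫ z : E2,
    a (x + z) * Complex.exp ((2 * Complex.I) *
      ((((z 1) * (x 0 - y 0) - (z 0) * (x 1 - y 1)) / θ : ℝ) : ℂ))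

/-- The phase `e^{2i z·Θ⁻¹(x−y)}` in the kernel of left Moyal multiplication. -/
def moyalPhase (θ : ℝ) (x z y : E2) : ℂ :=
  Complex.exp ((2 * Complex.I) *
    ((((z 1) * (x 0 - y 0) - (z 0) * (x 1 - y 1)) / θ : ℝ) : ℂ))

lemma norm_moyalPhase (θ : ℝ) (x z y : E2) : ‖moyalPhase θ x z y‖ = 1 := by
  rw [moyalPhase, mul_comm (2 : ℂ), mul_assoc, mul_comm Complex.I]
  exact_mod_cast Complex.norm_exp_ofReal_mul_I
    (2 * (((z 1) * (x 0 - y 0) - (z 0) * (x 1 - y 1)) / θ))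

lemma continuous_moyalPhase (θ : ℝ) (x : E2) :
    Continuous fun p : E2 × E2 => moyalPhase θ x p.1 p.2 := by
  unfold moyalPhase
  fun_prop

lemma integrable_mul_moyalPhase {f : E2 → ℂ} (hf : Integrable f) (θ : ℝ) (x y : E2) :
    Integrable fun z : E2 => f (x + z) * moyalPhase θ x z y :=
  (hf.comp_add_left x).mul_bdd (c := 1)
    ((continuous_moyalPhase θ x).comp (by fun_prop : Continuous fun z : E2 => (z, y))
      ).aestronglyMeasurable
    (.of_forall fun z => (norm_moyalPhase θ x z y).le)

lemma integrable_mul_moyalPhase_mul {f g : E2 → ℂ} (hf : Integrable f) (hg : Integrable g)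
    (θ : ℝ) (x : E2) :
    Integrable (fun p : E2 × E2 => f (x + p.1) * moyalPhase θ x p.1 p.2 * g p.2)
      (volume.prod volume) := by
  have h := ((hf.comp_add_left x).mul_prod hg).mul_bdd (c := 1)
    (continuous_moyalPhase θ x).aestronglyMeasurable
    (.of_forall fun p => (norm_moyalPhase θ x p.1 p.2).le)
  simpa only [mul_right_comm] using h

lemma KLa_mul_eq_smul_integral (θ : ℝ) (f g : E2 → ℂ) (x y : E2) :
    KLa θ f x y * g y =
      (((Real.pi * θ) ^ 2)⁻¹ : ℝ) • ∫ z : E2, f (x + z) * moyalPhase θ x z y * g y := by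
  rw [integral_mul_const, ← smul_mul_assoc]
  rfl

lemma moyal_eq_smul_integral (θ : ℝ) (f g : E2 → ℂ) (x : E2) :
    moyal θ f g x =
      (((Real.pi * θ) ^ 2)⁻¹ : ℝ) •
        ∫ z : E2, ∫ y : E2, f (x + z) * moyalPhase θ x z y * g y := by
  unfold moyal
  congr 2 with z
  refine Eq.trans ?_ (integral_add_left_eq_self _ x)
  congr 1 with w
  rw [moyalPhase, mul_right_comm]
  congr 3
  simp only [PiLp.add_apply]
  push_cast
  ring

/-- Left Moyal multiplication is an integral operator with kernel `K_{L(a)}`: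
`(a ⋆ ψ)(x) = ∫ K_{L(a)}(x,y) ψ(y) dy`, all integrals converging absolutely. -/
theorem moyal_kernel (θ : ℝ) (hθ : 0 < θ) (a ψ : SchwartzMap E2 ℂ) :
    ∀ x : E2,
      (∀ y : E2, Integrable (fun z : E2 => a (x + z) * Complex.exp ((2 * Complex.I) *
        ((((z 1) * (x 0 - y 0) - (z 0) * (x 1 - y 1)) / θ : ℝ) : ℂ)))) ∧
      Integrable (fun y : E2 => KLa θ (⇑a) x y * ψ y) ∧
      moyal θ (⇑a) (⇑ψ) x = ∫ y : E2, KLa θ (⇑a) x y * ψ y := by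
  intro x
  have ha : Integrable (⇑a) := a.integrable
  have hint := integrable_mul_moyalPhase_mul ha ψ.integrable θ x
  refine ⟨fun y => integrable_mul_moyalPhase ha θ x y, ?_, ?_⟩
  · simp only [KLa_mul_eq_smul_integral]
    exact hint.integral_prod_right.smul (((Real.pi * θ) ^ 2)⁻¹ : ℝ)
  · simp only [KLa_mul_eq_smul_integral]
    rw [moyal_eq_smul_integral, integral_smul, integral_integral_swap hint]

end
end

section
/- For every θ > 0 and every Schwartz function a : ℝ² → ℂ, define K : ℝ² × ℝ² → ℂ by K(x,y) := ∫_{ℝ²} a(x + ½Θp) (1+|p|²)^{−1} e^{−i p·(x−y)} dp. Then K is square integrable on ℝ² × ℝ², with ∬_{ℝ²×ℝ²} |K(x,y)|² dx dy = (2π)² · (∫_{ℝ²} (1+|p|²)^{−2} dp) · ∫_{ℝ²} |a(x)|² dx = 4π³ ‖a‖_{L²(ℝ²)}². (This is the kernel, up to a constant factor, of L(a)(−Δ+1)^{−1}, which is therefore a Hilbert–Schmidt operator on L²(ℝ²).) -/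
open MeasureTheory Complex RealInnerProductSpace

noncomputable section

/-- The vector `½Θp = (θp₂/2, −θp₁/2)`, with `Θ = θ·[[0,1],[−1,0]]`. -/
def halfTheta (θ : ℝ) (p : E2) : E2 :=
  (WithLp.equiv 2 (Fin 2 → ℝ)).symm ![θ * p 1 / 2, -(θ * p 0 / 2)]

/-- The kernel `K(x,y) = ∫ a(x + ½Θp)(1+|p|²)⁻¹ e^{−ip·(x−y)} dp` of
`L(a)(−Δ+1)⁻¹` up to a constant factor. -/
def Kres (θ : ℝ) (a : E2 → ℂ) (x y : E2) : ℂ :=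
  ∫ p : E2, a (x + halfTheta θ p) * (((1 + ‖p‖ ^ 2)⁻¹ : ℝ) : ℂ) *
    Complex.exp (-Complex.I * ((⟪p, x - y⟫ : ℝ) : ℂ))

open scoped FourierTransform

section HalfTheta

/-- The map `p ↦ ½Θp` as a continuous linear map. -/
def halfThetaCLM (θ : ℝ) : E2 →L[ℝ] E2 :=
  LinearMap.toContinuousLinearMap
    { toFun := halfTheta θ
      map_add' := fun p q => by
        ext i
        fin_cases i <;> simp [halfTheta] <;> ring
      map_smul' := fun c p => by
        ext i
        fin_cases i <;> simp [halfTheta] <;> ring }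

@[simp]
lemma halfThetaCLM_apply (θ : ℝ) (p : E2) : halfThetaCLM θ p = halfTheta θ p := rfl

lemma norm_halfTheta {θ : ℝ} (hθ : 0 ≤ θ) (p : E2) : ‖halfTheta θ p‖ = θ / 2 * ‖p‖ := by
  rw [EuclideanSpace.norm_eq, EuclideanSpace.norm_eq, Fin.sum_univ_two, Fin.sum_univ_two,
    ← Real.sqrt_sq (by positivity : 0 ≤ θ / 2), ← Real.sqrt_mul (by positivity)]
  congr 1
  simp only [halfTheta, WithLp.equiv_symm_apply, Real.norm_eq_abs, sq_abs, Matrix.cons_val_zero,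
    Matrix.cons_val_one]
  ring

@[fun_prop]
lemma continuous_halfTheta (θ : ℝ) : Continuous (halfTheta θ) :=
  (halfThetaCLM θ).continuous

lemma hasTemperateGrowth_add_halfTheta (θ : ℝ) (x : E2) :
    (fun p => x + halfTheta θ p).HasTemperateGrowth := by
  have h : (fun p => x + halfThetaCLM θ p).HasTemperateGrowth := by fun_prop
  exact h

lemma antilipschitzWith_add_halfTheta {θ : ℝ} (hθ : 0 < θ) (x : E2) :
    AntilipschitzWith (Real.toNNReal (2 / θ)) (fun p => x + halfTheta θ p) := by
  refine AntilipschitzWith.of_le_mul_dist fun p q => ?_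
  rw [dist_add_left, dist_eq_norm, dist_eq_norm, ← halfThetaCLM_apply, ← halfThetaCLM_apply,
    ← map_sub, halfThetaCLM_apply, norm_halfTheta hθ.le, Real.coe_toNNReal _ (by positivity)]
  exact le_of_eq (by field_simp)

end HalfTheta

section Weight

lemma hasTemperateGrowth_inv_one_add_norm_sq :
    (fun p : E2 => (((1 + ‖p‖ ^ 2)⁻¹ : ℝ) : ℂ)).HasTemperateGrowth := by
  have h : (fun p : E2 => (((1 + ‖p‖ ^ 2) ^ (-1 : ℝ) : ℝ) : ℂ)).HasTemperateGrowth := by fun_prop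
  simpa only [Real.rpow_neg_one] using h

lemma integrable_inv_one_add_norm_sq_sq :
    Integrable (fun p : E2 => ((1 + ‖p‖ ^ 2) ^ 2)⁻¹) := by
  have h := integrable_rpow_neg_one_add_norm_sq (E := E2) (μ := volume) (r := 4) (by norm_num)
  refine h.congr (.of_forall fun p => ?_)
  dsimp only
  rw [show (-4 / 2 : ℝ) = -(2 : ℕ) by norm_num, Real.rpow_neg (by positivity), Real.rpow_natCast]

lemma integral_Ioi_mul_inv_one_add_sq_sq :
    ∫ r in Set.Ioi (0 : ℝ), r * ((1 + r ^ 2) ^ 2)⁻¹ = 1 / 2 := by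
  have hderiv : ∀ r ∈ Set.Ici (0 : ℝ),
      HasDerivAt (fun r : ℝ => -(1 / 2) * (1 + r ^ 2)⁻¹) (r * ((1 + r ^ 2) ^ 2)⁻¹) r := by
    intro r _
    have h := ((((hasDerivAt_id r).pow 2).const_add 1).inv
      (by simp only [id, Pi.pow_apply]; positivity)).const_mul (-(1 / 2 : ℝ))
    convert! h using 1
    simp only [id, Pi.pow_apply]
    field_simp
    norm_num [mul_comm]
  have hlim : Filter.Tendsto (fun r : ℝ => -(1 / 2) * (1 + r ^ 2)⁻¹) Filter.atTop (nhds 0) := by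
    have h : Filter.Tendsto (fun r : ℝ => (1 + r ^ 2)⁻¹) Filter.atTop (nhds 0) :=
      (Filter.tendsto_atTop_add_const_left _ 1
        (Filter.tendsto_pow_atTop two_ne_zero)).inv_tendsto_atTop
    simpa using h.const_mul (-(1 / 2 : ℝ))
  rw [integral_Ioi_of_hasDerivAt_of_nonneg' hderiv
    (fun r hr => mul_nonneg (le_of_lt hr) (by positivity)) hlim]
  norm_num

lemma integral_inv_one_add_norm_sq_sq :
    ∫ p : E2, ((1 + ‖p‖ ^ 2) ^ 2)⁻¹ = Real.pi := by
  rw [integral_fun_norm_addHaar volume (fun r : ℝ => ((1 + r ^ 2) ^ 2)⁻¹)]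
  have hball : (volume : Measure E2).real (Metric.ball 0 1) = Real.pi := by
    simp [Measure.real, EuclideanSpace.volume_ball_fin_two, Real.pi_pos.le]
  simp only [finrank_euclideanSpace, Fintype.card_fin, hball, smul_eq_mul, Nat.add_one_sub_one,
    pow_one, integral_Ioi_mul_inv_one_add_sq_sq, nsmul_eq_mul]
  push_cast
  ring

end Weight

section Kernel

/-- For fixed `x`, the amplitude `p ↦ (1+|p|²)⁻¹ a(x + ½Θp)` as a Schwartz function. -/
def amplitude {θ : ℝ} (hθ : 0 < θ) (a : SchwartzMap E2 ℂ) (x : E2) : SchwartzMap E2 ℂ :=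
  SchwartzMap.smulLeftCLM ℂ (fun p : E2 => (((1 + ‖p‖ ^ 2)⁻¹ : ℝ) : ℂ))
    (SchwartzMap.compCLMOfAntilipschitz ℂ (hasTemperateGrowth_add_halfTheta θ x)
      (antilipschitzWith_add_halfTheta hθ x) a)

lemma amplitude_apply {θ : ℝ} (hθ : 0 < θ) (a : SchwartzMap E2 ℂ) (x p : E2) :
    amplitude hθ a x p = (((1 + ‖p‖ ^ 2)⁻¹ : ℝ) : ℂ) * a (x + halfTheta θ p) := by
  rw [amplitude, SchwartzMap.smulLeftCLM_apply_apply hasTemperateGrowth_inv_one_add_norm_sq]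
  rfl

lemma norm_amplitude_sq {θ : ℝ} (hθ : 0 < θ) (a : SchwartzMap E2 ℂ) (x p : E2) :
    ‖amplitude hθ a x p‖ ^ 2 = ‖a (x + halfTheta θ p)‖ ^ 2 * ((1 + ‖p‖ ^ 2) ^ 2)⁻¹ := by
  rw [amplitude_apply, norm_mul, mul_pow, Complex.norm_real, Real.norm_eq_abs, sq_abs, inv_pow,
    mul_comm]

lemma Kres_eq_fourier {θ : ℝ} (hθ : 0 < θ) (a : SchwartzMap E2 ℂ) (x y : E2) :
    Kres θ a x y = 𝓕 (amplitude hθ a x) ((2 * Real.pi)⁻¹ • (x - y)) := by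
  rw [SchwartzMap.fourier_coe, Real.fourier_eq', Kres]
  refine integral_congr_ae (.of_forall fun p => ?_)
  dsimp only
  rw [amplitude_apply, inner_smul_right, smul_eq_mul,
    show -2 * Real.pi * ((2 * Real.pi)⁻¹ * ⟪p, x - y⟫) = -⟪p, x - y⟫ by field_simp,
    show ((-⟪p, x - y⟫ : ℝ) : ℂ) * Complex.I = -Complex.I * ((⟪p, x - y⟫ : ℝ) : ℂ) by
      push_cast; ring]
  ring

lemma integral_norm_fourier_rescaled_sq (f : SchwartzMap E2 ℂ) (x : E2) :
    ∫ y : E2, ‖𝓕 f ((2 * Real.pi)⁻¹ • (x - y))‖ ^ 2 = (2 * Real.pi) ^ 2 * ∫ p : E2, ‖f p‖ ^ 2 := by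
  rw [integral_sub_left_eq_self (fun z : E2 => ‖𝓕 f ((2 * Real.pi)⁻¹ • z)‖ ^ 2) volume x,
    Measure.integral_comp_inv_smul volume (fun z : E2 => ‖𝓕 f z‖ ^ 2) (2 * Real.pi),
    f.integral_norm_sq_fourier, finrank_euclideanSpace, Fintype.card_fin, smul_eq_mul,
    abs_of_nonneg (by positivity)]

lemma integrable_norm_sq (f : SchwartzMap E2 ℂ) : Integrable (fun x : E2 => ‖f x‖ ^ 2) := by
  simpa using (f.memLp 2).integrable_norm_pow two_ne_zero

lemma integrable_norm_Kres_sq {θ : ℝ} (hθ : 0 < θ) (a : SchwartzMap E2 ℂ) (x : E2) :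
    Integrable (fun y : E2 => ‖Kres θ a x y‖ ^ 2) := by
  simp_rw [Kres_eq_fourier hθ]
  exact ((integrable_norm_sq (𝓕 (amplitude hθ a x))).comp_smul
    (inv_ne_zero Real.two_pi_pos.ne')).comp_sub_left x

lemma integral_norm_Kres_sq {θ : ℝ} (hθ : 0 < θ) (a : SchwartzMap E2 ℂ) (x : E2) :
    ∫ y : E2, ‖Kres θ a x y‖ ^ 2
      = (2 * Real.pi) ^ 2 * ∫ p : E2, ‖a (x + halfTheta θ p)‖ ^ 2 * ((1 + ‖p‖ ^ 2) ^ 2)⁻¹ := by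
  simp_rw [Kres_eq_fourier hθ, integral_norm_fourier_rescaled_sq, norm_amplitude_sq]

lemma stronglyMeasurable_Kres (θ : ℝ) (a : SchwartzMap E2 ℂ) :
    StronglyMeasurable (fun q : E2 × E2 => Kres θ a q.1 q.2) := by
  have hw : Continuous (fun p : E2 => (((1 + ‖p‖ ^ 2)⁻¹ : ℝ) : ℂ)) :=
    hasTemperateGrowth_inv_one_add_norm_sq.1.continuous
  have hc : Continuous (fun z : (E2 × E2) × E2 => a (z.1.1 + halfTheta θ z.2) *
      (((1 + ‖z.2‖ ^ 2)⁻¹ : ℝ) : ℂ) *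
      Complex.exp (-Complex.I * ((⟪z.2, z.1.1 - z.1.2⟫ : ℝ) : ℂ))) := by
    refine ((a.continuous.comp (by fun_prop)).mul (hw.comp continuous_snd)).mul ?_
    fun_prop
  exact hc.stronglyMeasurable.integral_prod_right'

lemma integral_norm_sq_mul_weight (θ : ℝ) (a : SchwartzMap E2 ℂ) (p : E2) :
    ∫ x : E2, ‖a (x + halfTheta θ p)‖ ^ 2 * ((1 + ‖p‖ ^ 2) ^ 2)⁻¹
      = (∫ x : E2, ‖a x‖ ^ 2) * ((1 + ‖p‖ ^ 2) ^ 2)⁻¹ := by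
  rw [integral_mul_const, integral_add_right_eq_self (fun x : E2 => ‖a x‖ ^ 2)]

lemma integrable_norm_sq_mul_weight (θ : ℝ) (a : SchwartzMap E2 ℂ) :
    Integrable (fun z : E2 × E2 =>
      ‖a (z.1 + halfTheta θ z.2)‖ ^ 2 * ((1 + ‖z.2‖ ^ 2) ^ 2)⁻¹) (volume.prod volume) := by
  have hmeas : AEStronglyMeasurable (fun z : E2 × E2 =>
      ‖a (z.1 + halfTheta θ z.2)‖ ^ 2 * ((1 + ‖z.2‖ ^ 2) ^ 2)⁻¹) (volume.prod volume) := by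
    refine Continuous.aestronglyMeasurable (Continuous.mul ?_ ?_)
    · exact (a.continuous.comp (by fun_prop)).norm.pow 2
    · exact Continuous.inv₀ (by fun_prop) fun z => by positivity
  refine (integrable_prod_iff' hmeas).2 ⟨.of_forall fun p => ?_, ?_⟩
  · exact ((integrable_norm_sq a).comp_add_right (halfTheta θ p)).mul_const
      ((1 + ‖p‖ ^ 2) ^ 2)⁻¹
  · refine (integrable_inv_one_add_norm_sq_sq.const_mul (∫ x : E2, ‖a x‖ ^ 2)).congr
      (.of_forall fun p => ?_)
    dsimp only
    rw [← integral_norm_sq_mul_weight θ a p]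
    refine integral_congr_ae (.of_forall fun x => ?_)
    exact (Real.norm_of_nonneg (by positivity)).symm

lemma integrable_norm_Kres_sq_prod {θ : ℝ} (hθ : 0 < θ) (a : SchwartzMap E2 ℂ) :
    Integrable (fun q : E2 × E2 => ‖Kres θ a q.1 q.2‖ ^ 2) (volume.prod volume) := by
  refine (integrable_prod_iff
    ((stronglyMeasurable_Kres θ a).norm.pow 2).aestronglyMeasurable).2
    ⟨.of_forall fun x => integrable_norm_Kres_sq hθ a x, ?_⟩
  refine ((integrable_norm_sq_mul_weight θ a).integral_prod_left.const_mul
    ((2 * Real.pi) ^ 2)).congr (.of_forall fun x => ?_)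
  dsimp only
  rw [← integral_norm_Kres_sq hθ a x]
  refine integral_congr_ae (.of_forall fun y => ?_)
  exact (Real.norm_of_nonneg (by positivity)).symm

lemma integral_norm_Kres_sq_prod {θ : ℝ} (hθ : 0 < θ) (a : SchwartzMap E2 ℂ) :
    ∫ q : E2 × E2, ‖Kres θ a q.1 q.2‖ ^ 2
      = (2 * Real.pi) ^ 2 * (∫ p : E2, ((1 + ‖p‖ ^ 2) ^ 2)⁻¹) * ∫ x : E2, ‖a x‖ ^ 2 := by
  rw [Measure.volume_eq_prod, integral_prod _ (integrable_norm_Kres_sq_prod hθ a)]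
  simp_rw [integral_norm_Kres_sq hθ a]
  rw [integral_const_mul, ← integral_prod _ (integrable_norm_sq_mul_weight θ a),
    integral_prod_symm _ (integrable_norm_sq_mul_weight θ a)]
  simp_rw [integral_norm_sq_mul_weight θ a]
  rw [integral_const_mul]
  ring

end Kernel

/-- The kernel of `L(a)(−Δ+1)⁻¹` is square integrable on ℝ²×ℝ², with
`∬|K|² = (2π)²·(∫(1+|p|²)⁻² dp)·‖a‖₂² = 4π³‖a‖₂²`; hence `L(a)(−Δ+1)⁻¹` is
Hilbert–Schmidt on L²(ℝ²). -/
theorem Kres_hilbertSchmidt (θ : ℝ) (hθ : 0 < θ) (a : SchwartzMap E2 ℂ) :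
    Integrable (fun q : E2 × E2 => ‖Kres θ (⇑a) q.1 q.2‖ ^ 2) ∧
    (∫ q : E2 × E2, ‖Kres θ (⇑a) q.1 q.2‖ ^ 2)
      = (2 * Real.pi) ^ 2 * (∫ p : E2, ((1 + ‖p‖ ^ 2) ^ 2)⁻¹) * ∫ x : E2, ‖a x‖ ^ 2 ∧
    (∫ q : E2 × E2, ‖Kres θ (⇑a) q.1 q.2‖ ^ 2)
      = 4 * Real.pi ^ 3 * ∫ x : E2, ‖a x‖ ^ 2 := by
  refine ⟨integrable_norm_Kres_sq_prod hθ a, integral_norm_Kres_sq_prod hθ a, ?_⟩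
  rw [integral_norm_Kres_sq_prod hθ a, integral_inv_one_add_norm_sq_sq]
  ring

end
end

section
/- Fix ξ > 0, θ > 0 and μ ∈ ℝ, and define Φ : ℝ² → ℝ by Φ(v) := ∫₀^∞ (e^{−tμ²}/(4π sinh t)) e^{−(ξ/θ)|v|² coth t} dt. Then Φ is square integrable on ℝ² and ∫_{ℝ²} Φ(v)² dv ≤ πθ/(48ξ). -/
open MeasureTheory

noncomputable section

/-- `Φ(v) = ∫₀^∞ (e^{−tμ²}/(4π sinh t)) e^{−(ξ/θ)|v|² coth t} dt`, the radial profile of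
the resolvent kernel of the Landau Hamiltonian. -/
def Phi (ξ θ μ : ℝ) (v : E2) : ℝ :=
  ∫ t in Set.Ioi (0:ℝ), Real.exp (-t * μ ^ 2) / (4 * Real.pi * Real.sinh t) *
    Real.exp (-(ξ / θ) * ‖v‖ ^ 2 * (Real.cosh t / Real.sinh t))

lemma lintegral_Ioi_lintegral_Ioi_comp_add {f : ℝ → ENNReal} (hf : Measurable f) :
    ∫⁻ s in Set.Ioi (0:ℝ), ∫⁻ t in Set.Ioi (0:ℝ), f (s + t) = ∫⁻ u, f u * ENNReal.ofReal u := by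
  have h1 (s : ℝ) : ∫⁻ t in Set.Ioi (0:ℝ), f (s + t) = ∫⁻ u, (Set.Ioi s).indicator f u := by
    rw [← lintegral_indicator measurableSet_Ioi,
      ← lintegral_add_left_eq_self (fun u => (Set.Ioi s).indicator f u) s]
    congr 1 with t
    simp [Set.indicator]
  simp_rw [h1]
  rw [lintegral_lintegral_swap]
  · congr 1 with u
    have h2 (s : ℝ) : (Set.Ioi s).indicator f u = (Set.Iio u).indicator (fun _ => f u) s := by
      simp [Set.indicator]
    simp_rw [h2]
    rw [lintegral_indicator_const measurableSet_Iio, Measure.restrict_apply measurableSet_Iio,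
      Set.inter_comm, Set.Ioi_inter_Iio, Real.volume_Ioo, sub_zero]
  · have h3 : MeasurableSet {p : ℝ × ℝ | p.1 < p.2} := measurableSet_lt measurable_fst measurable_snd
    exact ((hf.comp measurable_snd).indicator h3).aemeasurable

lemma lintegral_Ioi_inv_cosh_half :
    ∫⁻ u in Set.Ioi (0:ℝ), ENNReal.ofReal (1 / Real.cosh (u / 2)) = ENNReal.ofReal Real.pi := by
  have hd (u : ℝ) : HasDerivAt (fun u => 4 * Real.arctan (Real.exp (u / 2)))
      (1 / Real.cosh (u / 2)) u := by
    refine (((hasDerivAt_id' u).div_const 2).exp.arctan.const_mul 4).congr_deriv ?_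
    have hx := Real.exp_pos (u / 2)
    rw [Real.cosh_eq, Real.exp_neg]
    field_simp
    ring
  have hpos : ∀ u ∈ Set.Ioi (0:ℝ), 0 ≤ 1 / Real.cosh (u / 2) := fun u _ =>
    div_nonneg zero_le_one (Real.cosh_pos _).le
  have hlim : Filter.Tendsto (fun u : ℝ => 4 * Real.arctan (Real.exp (u / 2))) Filter.atTop
      (nhds (4 * (Real.pi / 2))) := by
    refine Filter.Tendsto.const_mul 4 ?_
    exact (Real.tendsto_arctan_atTop.mono_right nhdsWithin_le_nhds).comp
      (Real.tendsto_exp_atTop.comp (Filter.tendsto_id.atTop_div_const two_pos))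
  have hi := integrableOn_Ioi_deriv_of_nonneg' (fun u _ => hd u) hpos hlim
  have he := integral_Ioi_of_hasDerivAt_of_nonneg' (fun u _ => hd u) hpos hlim
  rw [← ofReal_integral_eq_lintegral_ofReal hi
    ((ae_restrict_iff' measurableSet_Ioi).2 (ae_of_all _ hpos)), he]
  congr 1
  simp only [zero_div, Real.exp_zero, Real.arctan_one]
  ring

lemma lintegral_lintegral_inv_sinh_add_le :
    ∫⁻ s in Set.Ioi (0:ℝ), ∫⁻ t in Set.Ioi (0:ℝ), ENNReal.ofReal (1 / Real.sinh (s + t))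
      ≤ ENNReal.ofReal Real.pi := by
  rw [lintegral_Ioi_lintegral_Ioi_comp_add (f := fun u => ENNReal.ofReal (1 / Real.sinh u))
    (Real.measurable_sinh.const_div 1).ennreal_ofReal, ← lintegral_Ioi_inv_cosh_half,
    ← lintegral_indicator measurableSet_Ioi]
  refine lintegral_mono fun u => ?_
  by_cases hu : 0 < u
  · rw [Set.indicator_of_mem (Set.mem_Ioi.2 hu), ← ENNReal.ofReal_mul' hu.le]
    refine ENNReal.ofReal_le_ofReal ?_
    have h1 : u / 2 ≤ Real.sinh (u / 2) := Real.self_le_sinh_iff.2 (by positivity)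
    have h2 : Real.sinh u = 2 * Real.sinh (u / 2) * Real.cosh (u / 2) := by
      rw [← Real.sinh_two_mul]; congr 1; ring
    have h3 := Real.cosh_pos (u / 2)
    have h4 : 0 < Real.sinh u := Real.sinh_pos_iff.2 hu
    rw [div_mul_eq_mul_div, one_mul, div_le_div_iff₀ h4 h3, h2]
    nlinarith
  · simp [ENNReal.ofReal_of_nonpos (not_lt.1 hu)]

/-- The integrand of `Phi` without the factor `e^{-tμ²}`, with `c = ξ/θ`. -/
def phiKernel (c t : ℝ) (v : E2) : ℝ :=
  1 / (4 * Real.pi * Real.sinh t) * Real.exp (-c * ‖v‖ ^ 2 * (Real.cosh t / Real.sinh t))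

lemma measurable_phiKernel (c : ℝ) : Measurable fun p : E2 × ℝ => phiKernel c p.2 p.1 := by
  have hs : Measurable fun p : E2 × ℝ => Real.sinh p.2 := Real.measurable_sinh.comp measurable_snd
  have hc : Measurable fun p : E2 × ℝ => Real.cosh p.2 := Real.measurable_cosh.comp measurable_snd
  unfold phiKernel
  fun_prop

lemma lintegral_exp_neg_mul_sq_norm {b : ℝ} (hb : 0 < b) :
    ∫⁻ v : E2, ENNReal.ofReal (Real.exp (-b * ‖v‖ ^ 2)) = ENNReal.ofReal (Real.pi / b) := by
  have h : ∫ v : E2, Real.exp (-b * ‖v‖ ^ 2) = Real.pi / b := by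
    rw [GaussianFourier.integral_rexp_neg_mul_sq_norm hb]
    simp
  have hi : Integrable fun v : E2 => Real.exp (-b * ‖v‖ ^ 2) := by
    by_contra hn
    rw [integral_undef hn] at h
    exact (div_pos Real.pi_pos hb).ne h
  rw [← ofReal_integral_eq_lintegral_ofReal hi (ae_of_all _ fun _ => (Real.exp_pos _).le), h]

lemma lintegral_phiKernel_mul_phiKernel {c s t : ℝ} (hc : 0 < c) (hs : 0 < s) (ht : 0 < t) :
    ∫⁻ v : E2, ENNReal.ofReal (phiKernel c s v) * ENNReal.ofReal (phiKernel c t v) =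
      ENNReal.ofReal (1 / (16 * Real.pi * c)) * ENNReal.ofReal (1 / Real.sinh (s + t)) := by
  have hss : 0 < Real.sinh s := Real.sinh_pos_iff.2 hs
  have hst : 0 < Real.sinh t := Real.sinh_pos_iff.2 ht
  have hcs := Real.cosh_pos s
  have hct := Real.cosh_pos t
  have hpi := Real.pi_pos
  set b := c * (Real.cosh s / Real.sinh s + Real.cosh t / Real.sinh t) with hb
  have hb0 : 0 < b := by positivity
  have h (v : E2) : ENNReal.ofReal (phiKernel c s v) * ENNReal.ofReal (phiKernel c t v) =
      ENNReal.ofReal (1 / (16 * Real.pi ^ 2 * Real.sinh s * Real.sinh t)) *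
        ENNReal.ofReal (Real.exp (-b * ‖v‖ ^ 2)) := by
    have he : Real.exp (-b * ‖v‖ ^ 2) =
        Real.exp (-c * ‖v‖ ^ 2 * (Real.cosh s / Real.sinh s)) *
          Real.exp (-c * ‖v‖ ^ 2 * (Real.cosh t / Real.sinh t)) := by
      rw [← Real.exp_add, hb]; congr 1; ring
    rw [← ENNReal.ofReal_mul (by unfold phiKernel; positivity),
      ← ENNReal.ofReal_mul (by positivity), he]
    unfold phiKernel
    congr 1
    field_simp
    norm_num
  simp_rw [h]
  rw [lintegral_const_mul' _ _ ENNReal.ofReal_ne_top, lintegral_exp_neg_mul_sq_norm hb0,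
    ← ENNReal.ofReal_mul (by positivity), ← ENNReal.ofReal_mul (by positivity)]
  congr 1
  rw [hb, Real.sinh_add]
  have : 0 < Real.sinh s * Real.cosh t + Real.cosh s * Real.sinh t := by positivity
  field_simp
  ring

lemma lintegral_sq_lintegral_eq {α β : Type*} [MeasurableSpace α] [MeasurableSpace β]
    (μ : Measure α) (ν : Measure β) [SFinite μ] [SFinite ν] {K : β → α → ENNReal}
    (hK : Measurable fun p : α × β => K p.2 p.1) :
    ∫⁻ a, (∫⁻ b, K b a ∂ν) ^ 2 ∂μ = ∫⁻ b, ∫⁻ b', ∫⁻ a, K b a * K b' a ∂μ ∂ν ∂ν := by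
  have hKa (a : α) : Measurable fun b => K b a := hK.comp measurable_prodMk_left
  have hKb (b : β) : Measurable fun a => K b a := hK.comp measurable_prodMk_right
  have hsq (a : α) : (∫⁻ b, K b a ∂ν) ^ 2 = ∫⁻ b, ∫⁻ b', K b a * K b' a ∂ν ∂ν := by
    simp_rw [lintegral_const_mul _ (hKa a)]
    rw [lintegral_mul_const _ (hKa a), sq]
  have hK3 : Measurable fun p : (α × β) × β => K p.1.2 p.1.1 * K p.2 p.1.1 :=
    (hK.comp measurable_fst).mul
      (hK.comp ((measurable_fst.comp measurable_fst).prodMk measurable_snd))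
  simp_rw [hsq]
  rw [lintegral_lintegral_swap hK3.lintegral_prod_right'.aemeasurable]
  refine lintegral_congr fun b => lintegral_lintegral_swap ?_
  exact (((hKb b).comp measurable_fst).mul hK).aemeasurable

lemma lintegral_sq_lintegral_phiKernel_le {c : ℝ} (hc : 0 < c) :
    ∫⁻ v : E2, (∫⁻ t in Set.Ioi (0:ℝ), ENNReal.ofReal (phiKernel c t v)) ^ 2 ≤
      ENNReal.ofReal (1 / (16 * c)) := by
  rw [lintegral_sq_lintegral_eq _ _ (K := fun t v => ENNReal.ofReal (phiKernel c t v))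
    (measurable_phiKernel c).ennreal_ofReal]
  calc _ = ∫⁻ s in Set.Ioi (0:ℝ), ∫⁻ t in Set.Ioi (0:ℝ),
        ENNReal.ofReal (1 / (16 * Real.pi * c)) * ENNReal.ofReal (1 / Real.sinh (s + t)) :=
        setLIntegral_congr_fun measurableSet_Ioi fun s hs =>
          setLIntegral_congr_fun measurableSet_Ioi fun t ht =>
            lintegral_phiKernel_mul_phiKernel hc hs ht
    _ = ENNReal.ofReal (1 / (16 * Real.pi * c)) * ∫⁻ s in Set.Ioi (0:ℝ),
        ∫⁻ t in Set.Ioi (0:ℝ), ENNReal.ofReal (1 / Real.sinh (s + t)) := by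
      simp_rw [lintegral_const_mul' _ _ ENNReal.ofReal_ne_top]
    _ ≤ ENNReal.ofReal (1 / (16 * Real.pi * c)) * ENNReal.ofReal Real.pi := by
      gcongr
      exact lintegral_lintegral_inv_sinh_add_le
    _ = ENNReal.ofReal (1 / (16 * c)) := by
      have hpi := Real.pi_pos
      rw [← ENNReal.ofReal_mul (by positivity)]
      congr 1
      field_simp

lemma measurable_Phi (ξ θ μ : ℝ) : Measurable (Phi ξ θ μ) := by
  have hm : Measurable fun p : E2 × ℝ =>
      Real.exp (-p.2 * μ ^ 2) / (4 * Real.pi * Real.sinh p.2) *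
        Real.exp (-(ξ / θ) * ‖p.1‖ ^ 2 * (Real.cosh p.2 / Real.sinh p.2)) := by
    have hs : Measurable fun p : E2 × ℝ => Real.sinh p.2 :=
      Real.measurable_sinh.comp measurable_snd
    have hc : Measurable fun p : E2 × ℝ => Real.cosh p.2 :=
      Real.measurable_cosh.comp measurable_snd
    fun_prop
  exact hm.stronglyMeasurable.integral_prod_right'.measurable

lemma enorm_Phi_le (ξ θ μ : ℝ) (v : E2) :
    ‖Phi ξ θ μ v‖ₑ ≤ ∫⁻ t in Set.Ioi (0:ℝ), ENNReal.ofReal (phiKernel (ξ / θ) t v) := by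
  refine (enorm_integral_le_lintegral_enorm _).trans
    (setLIntegral_mono' measurableSet_Ioi fun t ht => ?_)
  have hst : 0 < Real.sinh t := Real.sinh_pos_iff.2 ht
  have ht0 : 0 < t := ht
  have hpi := Real.pi_pos
  rw [Real.enorm_of_nonneg (by positivity)]
  refine ENNReal.ofReal_le_ofReal ?_
  unfold phiKernel
  gcongr
  refine Real.exp_le_one_iff.2 ?_
  nlinarith [mul_nonneg ht0.le (sq_nonneg μ)]

/-- `Φ` is square integrable on ℝ² with `∫ Φ² ≤ πθ/(48ξ)`. -/
theorem Phi_sq_integrable (ξ θ μ : ℝ) (hξ : 0 < ξ) (hθ : 0 < θ) :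
    Integrable (fun v : E2 => Phi ξ θ μ v ^ 2) ∧
    (∫ v : E2, Phi ξ θ μ v ^ 2) ≤ Real.pi * θ / (48 * ξ) := by
  have hbound : ∫⁻ v : E2, ‖Phi ξ θ μ v ^ 2‖ₑ ≤ ENNReal.ofReal (1 / (16 * (ξ / θ))) := by
    refine le_trans (lintegral_mono fun v => ?_)
      (lintegral_sq_lintegral_phiKernel_le (div_pos hξ hθ))
    rw [enorm_pow]
    gcongr
    exact enorm_Phi_le ξ θ μ v
  have hm : AEStronglyMeasurable (fun v : E2 => Phi ξ θ μ v ^ 2) :=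
    ((measurable_Phi ξ θ μ).pow_const 2).aestronglyMeasurable
  refine ⟨⟨hm, hbound.trans_lt ENNReal.ofReal_lt_top⟩, ?_⟩
  have hle : ∫ v : E2, Phi ξ θ μ v ^ 2 ≤ 1 / (16 * (ξ / θ)) := by
    rw [integral_eq_lintegral_of_nonneg_ae (ae_of_all _ fun v => sq_nonneg _) hm]
    refine ENNReal.toReal_le_of_le_ofReal (by positivity) ?_
    simpa only [Real.enorm_of_nonneg (sq_nonneg _)] using hbound
  refine hle.trans ?_
  rw [show 1 / (16 * (ξ / θ)) = 3 * θ / (48 * ξ) by field_simp; norm_num]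
  gcongr
  exact Real.pi_gt_three.le

end
end
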